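/- Let α = (1,2)(3,4)⋯(71,72) and β = (1,3)(2,4)⋯(70,72) in S₇₂, with fixed-space bijections π_α : V(α) → F₂³⁶ and π_β : V(β) → F₂³⁶. Let χ = (1,2)(3,4)⋯(35,36) ∈ S₃₆. Then for any subspace C ≤ F₂⁷² invariant under both α and β, π_α(C(α) ∩ C(β)) equals π_α(C(α))(χ), i.e. the image of C(α) ∩ C(β) under π_α is exactly the χ-fixed subcode of π_α(C(α)). -/

import Mathlib

/-- The coordinate-permutation action of `σ ∈ Sₙ` on `F₂ⁿ`: `(v^σ)ᵢ = v_{σ⁻¹(i)}`. -/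
def permVec {n : ℕ} (σ : Equiv.Perm (Fin n)) (v : Fin n → ZMod 2) : Fin n → ZMod 2 :=
  fun i => v (σ⁻¹ i)

/-- The action as a linear map. -/
def permLin {n : ℕ} (σ : Equiv.Perm (Fin n)) :
    (Fin n → ZMod 2) →ₗ[ZMod 2] (Fin n → ZMod 2) where
  toFun := permVec σ
  map_add' := fun _ _ => rfl
  map_smul' := fun _ _ => rfl

/-- The image `C^σ` of a code under a permutation. -/
def permCode {n : ℕ} (σ : Equiv.Perm (Fin n)) (C : Submodule (ZMod 2) (Fin n → ZMod 2)) :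
    Submodule (ZMod 2) (Fin n → ZMod 2) := C.map (permLin σ)

/-- The subcode of `C` fixed by `σ`. -/
def fixedCode {n : ℕ} (σ : Equiv.Perm (Fin n)) (C : Submodule (ZMod 2) (Fin n → ZMod 2)) :
    Submodule (ZMod 2) (Fin n → ZMod 2) where
  carrier := {c | c ∈ C ∧ permVec σ c = c}
  zero_mem' := ⟨C.zero_mem, rfl⟩
  add_mem' := by
    rintro a b ⟨ha, ha'⟩ ⟨hb, hb'⟩
    exact ⟨C.add_mem ha hb, by rw [show permVec σ (a + b) = permVec σ a + permVec σ b from rfl, ha', hb']⟩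
  smul_mem' := by
    rintro r v ⟨hv, hv'⟩
    exact ⟨C.smul_mem r hv, by rw [show permVec σ (r • v) = r • permVec σ v from rfl, hv']⟩

/-- `α = (1,2)(3,4)⋯(71,72)`: swaps coordinates `2i-1` and `2i` (here 0-indexed:
swaps `2i` and `2i+1`). -/
def alphaFun : Fin 72 → Fin 72 := fun i => ⟨2 * (i.1 / 2) + (1 - i.1 % 2), by omega⟩

lemma alphaFun_invol : Function.Involutive alphaFun := by intro x; revert x; decide

def alphaPerm : Equiv.Perm (Fin 72) := alphaFun_invol.toPerm

/-- `β = (1,3)(2,4)(5,7)(6,8)⋯(70,72)`: within each block of four consecutive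
coordinates swaps positions 1↔3 and 2↔4 (0-indexed: `i ↦ i ± 2` within blocks). -/
def betaFun : Fin 72 → Fin 72 := fun i => ⟨4 * (i.1 / 4) + ((i.1 % 4 + 2) % 4), by omega⟩

lemma betaFun_invol : Function.Involutive betaFun := by intro x; revert x; decide

def betaPerm : Equiv.Perm (Fin 72) := betaFun_invol.toPerm


/-- `χ = (1,2)(3,4)⋯(35,36) ∈ S₃₆`. -/
def chiFun : Fin 36 → Fin 36 := fun i => ⟨2 * (i.1 / 2) + (1 - i.1 % 2), by omega⟩

lemma chiFun_invol : Function.Involutive chiFun := by intro x; revert x; decide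

def chiPerm : Equiv.Perm (Fin 36) := chiFun_invol.toPerm

/-- `π_α` read off one coordinate per `α`-orbit (the bijection `V(α) → F₂³⁶`,
extended linearly to all of `F₂⁷²` by reading the first coordinate of each pair). -/
def piAlpha : (Fin 72 → ZMod 2) →ₗ[ZMod 2] (Fin 36 → ZMod 2) where
  toFun v := fun i => v ⟨2 * i.1, by omega⟩
  map_add' := fun _ _ => rfl
  map_smul' := fun _ _ => rfl

lemma permVec_comm_of_commute {n : ℕ} {σ τ : Equiv.Perm (Fin n)} (h : Commute σ τ)
    (v : Fin n → ZMod 2) : permVec σ (permVec τ v) = permVec τ (permVec σ v) :=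
  funext fun i => congrArg v (DFunLike.congr_fun h.inv_inv.eq.symm i)

lemma commute_alphaPerm_betaPerm : Commute alphaPerm betaPerm := by
  ext i
  change (alphaFun (betaFun i)).1 = (betaFun (alphaFun i)).1
  simp only [alphaFun, betaFun]
  omega

lemma piAlpha_permVec_betaPerm (v : Fin 72 → ZMod 2) :
    piAlpha (permVec betaPerm v) = permVec chiPerm (piAlpha v) := by
  funext i
  change v (betaFun ⟨2 * i.1, _⟩) = v ⟨2 * (chiFun i).1, _⟩
  congr 1
  ext
  simp only [betaFun, chiFun]
  omega

lemma piAlpha_injOn_fixed :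
    Set.InjOn piAlpha {v | permVec alphaPerm v = v} := by
  intro v hv w hw h
  have even (j : Fin 72) (hj : j.1 % 2 = 0) : v j = w j := by
    have := congrFun h ⟨j.1 / 2, by omega⟩
    change v ⟨2 * (j.1 / 2), _⟩ = w ⟨2 * (j.1 / 2), _⟩ at this
    convert this using 2 <;> ext <;> simp only <;> omega
  funext j
  rcases Nat.mod_two_eq_zero_or_one j.1 with hj | hj
  · exact even j hj
  · rw [← congrFun hv j, ← congrFun hw j]
    refine even (alphaFun j) ?_
    simp only [alphaFun]
    omega

/-- For a code `C` invariant under `α` and `β`,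
`π_α(C(α) ∩ C(β)) = (π_α(C(α)))(χ)`. -/
theorem piAlpha_inter_eq_fixed (C : Submodule (ZMod 2) (Fin 72 → ZMod 2))
    (hα : permCode alphaPerm C = C) (hβ : permCode betaPerm C = C) :
    Submodule.map piAlpha (fixedCode alphaPerm C ⊓ fixedCode betaPerm C) =
      fixedCode chiPerm (Submodule.map piAlpha (fixedCode alphaPerm C)) := by
  apply le_antisymm
  · rintro _ ⟨c, ⟨hcα, hcβ⟩, rfl⟩
    refine ⟨⟨c, hcα, rfl⟩, ?_⟩
    rw [← piAlpha_permVec_betaPerm, hcβ.2]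
  · rintro _ ⟨⟨c, hc, rfl⟩, hχ⟩
    refine ⟨c, ⟨hc, hc.1, piAlpha_injOn_fixed ?_ hc.2 ?_⟩, rfl⟩
    · change permVec alphaPerm (permVec betaPerm c) = permVec betaPerm c
      rw [permVec_comm_of_commute commute_alphaPerm_betaPerm, hc.2]
    · rw [piAlpha_permVec_betaPerm, hχ]
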